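/- The packing number A(95,4,4) equals the Johnson bound J(95,4,4). -/

import Mathlib

/-- A 3-(n,4,1) packing design (packing quadruple system PQS(n)) on the point
set `Fin n`: a collection of 4-element blocks such that every 3-element subset
of points is contained in at most one block. -/
def IsPQS (n : ℕ) (B : Finset (Finset (Fin n))) : Prop :=
  (∀ b ∈ B, b.card = 4) ∧
  ∀ t : Finset (Fin n), t.card = 3 → (B.filter (fun b => t ⊆ b)).card ≤ 1

/-- The packing number A(n,4,4): the maximum number of blocks in a
3-(n,4,1) packing design. -/
noncomputable def packingNumber (n : ℕ) : ℕ :=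
  sSup {N | ∃ B : Finset (Finset (Fin n)), IsPQS n B ∧ B.card = N}

/-- The Johnson bound J(n,4,4). -/
def johnsonBound (n : ℕ) : ℕ :=
  if n % 6 = 0 then n * ((n - 1) * ((n - 2) / 2) / 3) / 4 - 1
  else n * ((n - 1) * ((n - 2) / 2) / 3) / 4

/-! ### The Johnson upper bound -/

section JohnsonBound

variable {n : ℕ} {B : Finset (Finset (Fin n))}

/-- Counting pairs `(z, b)` with `z ∉ s` and `insert z s ⊆ b`. -/
lemma IsPQS.sum_degree_insert (hB : IsPQS n B) (s : Finset (Fin n)) :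
    ∑ z ∈ sᶜ, (B.filter (fun b => insert z s ⊆ b)).card =
      (4 - s.card) * (B.filter (fun b => s ⊆ b)).card := by
  have hfilter : ∀ z, B.filter (fun b => insert z s ⊆ b) =
      (B.filter (fun b => s ⊆ b)).filter (fun b => z ∈ b) := by
    intro z
    ext b
    simp only [Finset.mem_filter, Finset.insert_subset_iff]
    tauto
  simp_rw [hfilter]
  refine (Finset.sum_card_bipartiteAbove_eq_sum_card_bipartiteBelow (fun z b => z ∈ b)).trans ?_
  rw [mul_comm, ← smul_eq_mul, ← Finset.sum_const]
  refine Finset.sum_congr rfl fun b hb => ?_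
  obtain ⟨hbB, hsb⟩ := Finset.mem_filter.1 hb
  rw [← hB.1 b hbB, ← Finset.card_sdiff_of_subset hsb]
  congr 1
  ext z
  simp [Finset.bipartiteBelow, and_comm]

/-- If every one-point extension of `s` has degree at most `d`, then the degree of `s` is at
most `(n - |s|) d / (4 - |s|)`. -/
lemma IsPQS.degree_le (hB : IsPQS n B) (s : Finset (Fin n)) (d : ℕ)
    (hd : ∀ z ∉ s, (B.filter (fun b => insert z s ⊆ b)).card ≤ d) :
    (4 - s.card) * (B.filter (fun b => s ⊆ b)).card ≤ (n - s.card) * d := by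
  rw [← hB.sum_degree_insert s]
  refine (Finset.sum_le_card_nsmul _ _ d fun z hz => hd z (Finset.mem_compl.1 hz)).trans ?_
  rw [Finset.card_compl, Fintype.card_fin, smul_eq_mul]

lemma IsPQS.card_le (hB : IsPQS n B) :
    B.card ≤ n * ((n - 1) * ((n - 2) / 2) / 3) / 4 := by
  have hpair : ∀ s : Finset (Fin n), s.card = 2 →
      (B.filter (fun b => s ⊆ b)).card ≤ (n - 2) / 2 := by
    intro s hs
    have h := hB.degree_le s 1 fun z hz =>
      hB.2 _ (by rw [Finset.card_insert_of_notMem hz, hs])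
    rw [hs] at h
    omega
  have hpoint : ∀ s : Finset (Fin n), s.card = 1 →
      (B.filter (fun b => s ⊆ b)).card ≤ (n - 1) * ((n - 2) / 2) / 3 := by
    intro s hs
    have h := hB.degree_le s ((n - 2) / 2) fun z hz =>
      hpair _ (by rw [Finset.card_insert_of_notMem hz, hs])
    rw [hs] at h
    omega
  have h := hB.degree_le ∅ ((n - 1) * ((n - 2) / 2) / 3) fun z hz =>
    hpoint _ (by rw [Finset.card_insert_of_notMem hz, Finset.card_empty])
  simp only [Finset.card_empty, Finset.empty_subset, Finset.filter_true, Nat.sub_zero] at h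
  omega

end JohnsonBound

/-! ### Packings given by lists of blocks -/

/-- The elements of a set of natural numbers that are less than `n`, as a subset of `Fin n`. -/
def toFinFinset (n : ℕ) (b : Finset ℕ) : Finset (Fin n) :=
  Finset.univ.filter fun i => (i : ℕ) ∈ b

lemma map_toFinFinset {n : ℕ} {b : Finset ℕ} (hb : ∀ x ∈ b, x < n) :
    (toFinFinset n b).map Fin.valEmbedding = b := by
  ext x
  simp only [toFinFinset, Finset.mem_map, Finset.mem_filter, Finset.mem_univ, true_and,
    Fin.valEmbedding_apply]
  exact ⟨fun ⟨i, hi, hx⟩ => hx ▸ hi, fun hx => ⟨⟨x, hb x hx⟩, hx, rfl⟩⟩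

/-- A list of 4-subsets of `{0, …, n - 1}`, no two of which share three points, is a packing. -/
lemma exists_isPQS_of_list {n : ℕ} (L : List (Finset ℕ))
    (hcard : ∀ b ∈ L, b.card = 4) (hlt : ∀ b ∈ L, ∀ x ∈ b, x < n)
    (hL : L.Pairwise fun b c => (b ∩ c).card < 3) :
    ∃ B, IsPQS n B ∧ B.card = L.length := by
  have hmap : ∀ b ∈ L, (toFinFinset n b).map Fin.valEmbedding = b :=
    fun b hb => map_toFinFinset (hlt b hb)
  have hcard' : ∀ b ∈ L, (toFinFinset n b).card = 4 := fun b hb => by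
    rw [← hcard b hb, ← Finset.card_map Fin.valEmbedding, hmap b hb]
  have hL' : (L.map (toFinFinset n)).Pairwise fun b c => (b ∩ c).card < 3 := by
    rw [List.pairwise_map]
    refine hL.imp_of_mem fun {b c} hb hc h => ?_
    rwa [← Finset.card_map Fin.valEmbedding, Finset.map_inter, hmap b hb, hmap c hc]
  have hnodup : (L.map (toFinFinset n)).Nodup := by
    refine hL'.imp_of_mem fun {b c} hb _ h heq => ?_
    obtain ⟨a, ha, rfl⟩ := List.mem_map.1 hb
    rw [← heq, Finset.inter_self, hcard' a ha] at h
    omega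
  refine ⟨(L.map (toFinFinset n)).toFinset, ⟨?_, fun t ht => ?_⟩, ?_⟩
  · simpa using hcard'
  · refine Finset.card_le_one.2 fun b hb c hc => ?_
    by_contra hbc
    simp only [Finset.mem_filter, List.mem_toFinset] at hb hc
    have hsymm : Std.Symm fun b c : Finset (Fin n) => (b ∩ c).card < 3 :=
      ⟨fun b c h => by rwa [Finset.inter_comm]⟩
    have h := hL'.forall hb.1 hc.1 hbc
    have := Finset.card_le_card (Finset.subset_inter hb.2 hc.2)
    omega
  · rw [List.toFinset_card_of_nodup hnodup, List.length_map]

/-! ### A bit mask test for packings -/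

/-- A numerical code of a list of points. -/
def tripleCode (t : List ℕ) : ℕ := t.foldl (fun a x => 32 * a + x) 0

/-- The set of codes of the triples of a block, as a bit mask. -/
def tripleMask (b : List ℕ) : ℕ :=
  ((b.insertionSort (· ≤ ·)).sublistsLen 3).foldr (fun t m => Nat.lor (2 ^ tripleCode t) m) 0

/-- Whether the masks in a list are disjoint from `m` and from each other. -/
def masksDisjoint : List ℕ → ℕ → Bool
  | [], _ => true
  | b :: l, m => Nat.beq (Nat.land m b) 0 && masksDisjoint l (Nat.lor m b)

lemma masksDisjoint_spec (l : List ℕ) (m : ℕ) (h : masksDisjoint l m = true) :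
    (∀ b ∈ l, ∀ i, m.testBit i = true → b.testBit i = false) ∧
      l.Pairwise fun b c => ∀ i, b.testBit i = true → c.testBit i = false := by
  induction l generalizing m with
  | nil => simp
  | cons b l ih =>
    simp only [masksDisjoint, Bool.and_eq_true] at h
    obtain ⟨hb, hl⟩ := h
    obtain ⟨h₁, h₂⟩ := ih _ hl
    have hor : ∀ i, (Nat.lor m b).testBit i = (m.testBit i || b.testBit i) :=
      fun i => Nat.testBit_or m b i
    refine ⟨?_, List.pairwise_cons.2 ⟨fun c hc i hi => h₁ c hc i (by rw [hor, hi]; simp), h₂⟩⟩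
    intro c hc i hi
    rcases List.mem_cons.1 hc with rfl | hc
    · have : (m &&& c).testBit i = false := by
        rw [show m &&& c = 0 from Nat.eq_of_beq_eq_true hb, Nat.zero_testBit]
      simpa [Nat.testBit_and, hi] using this
    · exact h₁ c hc i (by rw [hor, hi]; simp)

lemma testBit_tripleMask {b t : List ℕ} (h : t.Sublist (b.insertionSort (· ≤ ·)))
    (ht : t.length = 3) : (tripleMask b).testBit (tripleCode t) = true := by
  have key : ∀ L : List (List ℕ), t ∈ L →
      (L.foldr (fun t m => Nat.lor (2 ^ tripleCode t) m) 0).testBit (tripleCode t) = true := by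
    intro L
    induction L with
    | nil => simp
    | cons a L ih =>
      intro hmem
      rw [List.foldr_cons]
      refine (Nat.testBit_or _ _ _).trans ?_
      rcases List.mem_cons.1 hmem with rfl | hmem
      · simp
      · rw [ih hmem, Bool.or_true]
  exact key _ (List.mem_sublistsLen.2 ⟨h, ht⟩)

lemma sort_sublist_insertionSort {b : List ℕ} {t : Finset ℕ} (h : t ⊆ b.toFinset) :
    (t.sort (· ≤ ·)).Sublist (b.insertionSort (· ≤ ·)) := by
  refine List.sublist_of_subperm_of_pairwise (r := (· ≤ ·)) ?_ (Finset.pairwise_sort _ _)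
    (List.pairwise_insertionSort _ _)
  refine (List.subperm_of_subset (Finset.sort_nodup _ _) fun x hx => ?_).trans
    (List.perm_insertionSort _ _).symm.subperm
  simpa using h (by simpa using hx)

/-- No two blocks of the list share three points. -/
def IsPackingList (S : List (List ℕ)) : Prop :=
  S.Pairwise fun b c => (b.toFinset ∩ c.toFinset).card < 3

lemma isPackingList_of_masksDisjoint {S : List (List ℕ)}
    (h : masksDisjoint (S.map tripleMask) 0 = true) : IsPackingList S := by
  refine (List.pairwise_map.1 (masksDisjoint_spec _ _ h).2).imp fun {b c} hbc => ?_
  by_contra hcard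
  obtain ⟨t, ht, ht3⟩ := Finset.exists_subset_card_eq (not_lt.1 hcard)
  have hlen : (t.sort (· ≤ ·)).length = 3 := by rw [Finset.length_sort, ht3]
  have hb := testBit_tripleMask
    (sort_sublist_insertionSort (ht.trans Finset.inter_subset_left)) hlen
  have hc := testBit_tripleMask
    (sort_sublist_insertionSort (ht.trans Finset.inter_subset_right)) hlen
  simp [hbc _ hb] at hc

/-! ### Gluing packings along a configuration of cells

The points `6 * i + u` with `i < 16` and `u < 6` are split into sixteen groups of size six; the
last group is the stem, and its last point is dropped. A cell is a set of groups carrying a packing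
which is described on the points `6 * j + u`, where `j` is a position in the list of the groups. -/

/-- The number of groups met by `t` or contained in `stem`. -/
def spread (stem t : List ℕ) : ℕ := (t.map (· / 6) ++ stem).dedup.length

/-- A packing by quadruples on `m` groups of six points, the groups in `stem` lacking their last
point, all of whose covered triples have spread at least `k`. -/
def IsIngredient (m : ℕ) (stem : List ℕ) (k : ℕ) (S : List (List ℕ)) : Prop :=
  IsPackingList S ∧ ∀ b ∈ S, b.length = 4 ∧ b.Nodup ∧
    (∀ x ∈ b, x / 6 < m ∧ (x / 6 ∈ stem → x % 6 < 5)) ∧ ∀ t ∈ b.sublistsLen 3, k ≤ spread stem t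

/-- A list of groups, the positions of the stem in it, a bound for the spread of the covered
triples, and a list of blocks. -/
structure Cell where
  groups : List ℕ
  stem : List ℕ
  strength : ℕ
  blocks : List (List ℕ)

namespace Cell

/-- The point of the design described by a point of the packing on the cell. -/
def point (c : Cell) (x : ℕ) : ℕ := 6 * c.groups.getD (x / 6) 0 + x % 6

/-- The blocks of the design described by the packing on the cell. -/
def designBlocks (c : Cell) : List (Finset ℕ) :=
  c.blocks.map fun b => b.toFinset.image c.point

/-- The groups of a cell are distinct and the stem sits at the given positions. -/
def HasGoodGroups (c : Cell) : Prop :=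
  c.groups.Nodup ∧ (∀ i ∈ c.stem, i < c.groups.length) ∧
    ∀ i < c.groups.length, c.groups.getD i 0 < 16 ∧ (c.groups.getD i 0 = 15 ↔ i ∈ c.stem)

instance (c : Cell) : Decidable c.HasGoodGroups := by unfold HasGoodGroups; infer_instance

/-- The cell carries a packing of the announced kind. -/
structure IsValid (c : Cell) : Prop where
  groups : c.HasGoodGroups
  blocks : IsIngredient c.groups.length c.stem c.strength c.blocks

/-- The number of common groups of two cells. -/
def overlap (c d : Cell) : ℕ := (c.groups.toFinset ∩ d.groups.toFinset).card

/-- The two cells have too few common groups for their blocks to have a common triple. -/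
def IsSeparated (c d : Cell) : Prop :=
  c.overlap d < c.strength ∧ (15 ∈ d.groups ∨ c.overlap d < d.strength)

instance (c d : Cell) : Decidable (c.IsSeparated d) := by unfold IsSeparated; infer_instance

variable {c d : Cell}

lemma point_div (c : Cell) (x : ℕ) : c.point x / 6 = c.groups.getD (x / 6) 0 := by
  unfold point
  omega

lemma HasGoodGroups.getD_injOn (h : c.HasGoodGroups) :
    Set.InjOn (fun i => c.groups.getD i 0) {i | i < c.groups.length} := by
  intro i hi j hj hij
  simp only [Set.mem_ofPred_eq] at hi hj
  simp only [List.getD_eq_getElem _ _ hi, List.getD_eq_getElem _ _ hj] at hij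
  exact (h.1.getElem_inj_iff).1 hij

lemma getD_mem_groups {i : ℕ} (hi : i < c.groups.length) : c.groups.getD i 0 ∈ c.groups := by
  rw [List.getD_eq_getElem _ _ hi]
  exact List.getElem_mem hi

lemma HasGoodGroups.point_injOn (h : c.HasGoodGroups) :
    Set.InjOn c.point {x | x / 6 < c.groups.length} := by
  intro x hx y hy hxy
  have hdiv : x / 6 = y / 6 :=
    h.getD_injOn hx hy (by
      change c.groups.getD (x / 6) 0 = c.groups.getD (y / 6) 0
      rw [← point_div, ← point_div, hxy])
  simp only [point, hdiv] at hxy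
  omega

namespace IsValid

lemma point_injOn (h : c.IsValid) {b : List ℕ} (hb : b ∈ c.blocks) :
    Set.InjOn c.point b.toFinset :=
  h.groups.point_injOn.mono fun x hx =>
    ((h.blocks.2 b hb).2.2.1 x (by simpa using hx)).1

lemma card_eq_four (h : c.IsValid) : ∀ b ∈ c.designBlocks, b.card = 4 := by
  intro b hb
  obtain ⟨b, hb', rfl⟩ := List.mem_map.1 hb
  obtain ⟨hlen, hnodup, -⟩ := h.blocks.2 b hb'
  rw [Finset.card_image_of_injOn (h.point_injOn hb'), List.toFinset_card_of_nodup hnodup, hlen]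

lemma div_mem_groups (h : c.IsValid) : ∀ b ∈ c.designBlocks, ∀ x ∈ b, x / 6 ∈ c.groups := by
  intro b hb y hy
  obtain ⟨b, hb', rfl⟩ := List.mem_map.1 hb
  obtain ⟨x, hx, rfl⟩ := Finset.mem_image.1 hy
  rw [point_div]
  exact getD_mem_groups ((h.blocks.2 b hb').2.2.1 x (List.mem_toFinset.1 hx)).1

lemma lt_of_mem (h : c.IsValid) : ∀ b ∈ c.designBlocks, ∀ x ∈ b, x < 95 := by
  intro b hb y hy
  obtain ⟨b, hb', rfl⟩ := List.mem_map.1 hb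
  obtain ⟨x, hx, rfl⟩ := Finset.mem_image.1 hy
  obtain ⟨hlt, hstem⟩ := (h.blocks.2 b hb').2.2.1 x (List.mem_toFinset.1 hx)
  obtain ⟨h16, h15⟩ := h.groups.2.2 _ hlt
  unfold point
  by_cases hx15 : c.groups.getD (x / 6) 0 = 15
  · have := hstem (h15.1 hx15)
    omega
  · omega

lemma pairwise_designBlocks (h : c.IsValid) :
    c.designBlocks.Pairwise fun b b' => (b ∩ b').card < 3 := by
  refine List.pairwise_map.2 (h.blocks.1.imp_of_mem fun {a b} ha hb hab => ?_)
  have hinj : Set.InjOn c.point (a.toFinset ∪ b.toFinset : Set ℕ) := by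
    refine h.groups.point_injOn.mono ?_
    rintro x (hx | hx)
    · exact ((h.blocks.2 a ha).2.2.1 x (by simpa using hx)).1
    · exact ((h.blocks.2 b hb).2.2.1 x (by simpa using hx)).1
  rw [← Finset.image_inter_of_injOn _ _ hinj]
  exact Finset.card_image_le.trans_lt hab

/-- A triple in a block, together with the stem of the cell, meets many groups. -/
lemma strength_le (h : c.IsValid) {b t : Finset ℕ} (hb : b ∈ c.designBlocks) (htb : t ⊆ b)
    (ht : t.card = 3) :
    c.strength ≤ (t.image (· / 6) ∪ (c.groups.toFinset ∩ {15})).card := by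
  obtain ⟨b, hb', rfl⟩ := List.mem_map.1 hb
  obtain ⟨s, hs, rfl⟩ := Finset.subset_image_iff.1 htb
  obtain ⟨-, hnodup, hpts, hspread⟩ := h.blocks.2 b hb'
  rw [Finset.card_image_of_injOn ((h.point_injOn hb').mono hs)] at ht
  have hfilter : (b.filter (· ∈ s)).toFinset = s := by
    ext x
    simp only [List.mem_toFinset, List.mem_filter, decide_eq_true_eq, and_iff_right_iff_imp]
    exact fun hx => List.mem_toFinset.1 (hs hx)
  have hlen : (b.filter (· ∈ s)).length = 3 := by
    rw [← List.toFinset_card_of_nodup (hnodup.filter _), hfilter, ht]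
  refine (hspread _ (List.mem_sublistsLen.2 ⟨List.filter_sublist, hlen⟩)).trans ?_
  rw [spread, ← List.card_toFinset]
  have hmaps : ∀ i ∈ ((b.filter (· ∈ s)).map (· / 6) ++ c.stem).toFinset,
      i < c.groups.length ∧
        c.groups.getD i 0 ∈ (s.image c.point).image (· / 6) ∪ (c.groups.toFinset ∩ {15}) := by
    intro i hi
    simp only [List.toFinset_append, Finset.mem_union, List.mem_toFinset, List.mem_map,
      List.mem_filter, decide_eq_true_eq] at hi
    rcases hi with ⟨x, ⟨hxb, hxs⟩, rfl⟩ | hi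
    · refine ⟨(hpts x hxb).1, Finset.mem_union_left _ ?_⟩
      rw [← point_div]
      exact Finset.mem_image_of_mem _ (Finset.mem_image_of_mem _ hxs)
    · have hlt := h.groups.2.1 i hi
      refine ⟨hlt, Finset.mem_union_right _ (Finset.mem_inter.2 ⟨?_, ?_⟩)⟩
      · exact List.mem_toFinset.2 (getD_mem_groups hlt)
      · exact Finset.mem_singleton.2 ((h.groups.2.2 i hlt).2.2 hi)
  exact Finset.card_le_card_of_injOn _ (fun i hi => (hmaps i hi).2)
    (h.groups.getD_injOn.mono fun i hi => (hmaps i hi).1)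

lemma card_inter_lt (hc : c.IsValid) (hd : d.IsValid) (h : c.IsSeparated d) {b b' : Finset ℕ}
    (hb : b ∈ c.designBlocks) (hb' : b' ∈ d.designBlocks) : (b ∩ b').card < 3 := by
  by_contra hcard
  obtain ⟨t, ht, ht3⟩ := Finset.exists_subset_card_eq (not_lt.1 hcard)
  have htb := ht.trans Finset.inter_subset_left
  have htb' := ht.trans Finset.inter_subset_right
  have himage : t.image (· / 6) ⊆ c.groups.toFinset ∩ d.groups.toFinset := by
    intro i hi
    obtain ⟨x, hx, rfl⟩ := Finset.mem_image.1 hi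
    simp only [Finset.mem_inter, List.mem_toFinset]
    exact ⟨hc.div_mem_groups b hb x (htb hx), hd.div_mem_groups b' hb' x (htb' hx)⟩
  have hc3 := hc.strength_le hb htb ht3
  have hd3 := hd.strength_le hb' htb' ht3
  by_cases hmem : 15 ∈ d.groups
  · have hsub : t.image (· / 6) ∪ (c.groups.toFinset ∩ {15}) ⊆
        c.groups.toFinset ∩ d.groups.toFinset :=
      Finset.union_subset himage (Finset.inter_subset_inter_left (by simpa using hmem))
    exact absurd h.1 (not_lt.2 (hc3.trans (Finset.card_le_card hsub)))
  · have hempty : d.groups.toFinset ∩ {15} = ∅ :=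
      Finset.inter_singleton_of_notMem (by simpa using hmem)
    rw [hempty, Finset.union_empty] at hd3
    exact absurd (h.2.resolve_left hmem) (not_lt.2 (hd3.trans (Finset.card_le_card himage)))

end IsValid

/-- Valid and pairwise separated cells give a packing on 95 points. -/
lemma exists_isPQS (C : List Cell) (hC : ∀ c ∈ C, c.IsValid) (hsep : C.Pairwise IsSeparated) :
    ∃ B, IsPQS 95 B ∧ B.card = (C.map fun c => c.blocks.length).sum := by
  obtain ⟨B, hB, hcard⟩ := exists_isPQS_of_list (n := 95) (C.flatMap designBlocks)
    (fun b hb => by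
      obtain ⟨c, hc, hb⟩ := List.mem_flatMap.1 hb
      exact (hC c hc).card_eq_four b hb)
    (fun b hb => by
      obtain ⟨c, hc, hb⟩ := List.mem_flatMap.1 hb
      exact (hC c hc).lt_of_mem b hb)
    (List.pairwise_flatMap.2 ⟨fun c hc => (hC c hc).pairwise_designBlocks,
      hsep.imp_of_mem fun {c d} hc hd h b hb b' hb' =>
        (hC c hc).card_inter_lt (hC d hd) h hb hb'⟩)
  refine ⟨B, hB, ?_⟩
  simp [hcard, List.length_flatMap, designBlocks]

end Cell

/-! ### The ingredients -/

/-- The first `k` images of the given blocks under the powers of `f`. -/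
def orbits (f : ℕ → ℕ) (k : ℕ) (S : List (List ℕ)) : List (List ℕ) :=
  S.flatMap fun b => List.iterate (List.map f) b k

/-- The H-design with four groups of size six given by the addition table modulo six. -/
def hDesignFour : List (List ℕ) :=
  (List.range 6).flatMap fun a => (List.range 6).flatMap fun b => (List.range 6).map fun c =>
    [a, 6 + b, 12 + c, 18 + (a + b + c) % 6]

/-- A one-factorization of the complete graph on `{0, …, 5}`. -/
def oneFactors : List (List (ℕ × ℕ)) :=
  (List.range 5).map fun k => [(5, k), ((k + 1) % 5, (k + 4) % 5), ((k + 2) % 5, (k + 3) % 5)]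

/-- A candelabra system with three groups of size six and a stem of size six whose last point is
removed together with its blocks. -/
def candelabraThree : List (List ℕ) :=
  hDesignFour.filter (23 ∉ ·) ++
    [(0, 6), (0, 12), (6, 12)].flatMap fun g => oneFactors.flatMap fun F =>
      F.flatMap fun e => F.map fun e' => [g.1 + e.1, g.1 + e.2, g.2 + e'.1, g.2 + e'.2]

/-- An automorphism of order fifteen of `hDesignFive`. -/
def rotationH (x : ℕ) : ℕ := 6 * ((x / 6 + 1) % 5) + (x % 6 + 2) % 6

/-- An H-design with five groups of size six. -/
def hDesignFive : List (List ℕ) :=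
  orbits rotationH 15
    [[0, 6, 12, 21], [0, 6, 13, 19], [0, 6, 14, 29], [0, 6, 16, 25], [0, 6, 17, 18], [0, 6, 20, 28],
     [0, 6, 22, 27], [0, 6, 23, 26], [0, 7, 12, 20], [0, 7, 14, 27], [0, 7, 15, 23], [0, 7, 16, 18],
     [0, 7, 17, 28], [0, 7, 19, 29], [0, 7, 21, 25], [0, 7, 22, 26], [0, 8, 12, 26], [0, 8, 13, 21],
     [0, 8, 17, 29], [0, 9, 12, 25], [0, 9, 13, 26], [0, 9, 14, 19], [0, 9, 15, 27], [0, 9, 16, 20],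
     [0, 9, 17, 22], [0, 9, 23, 29], [0, 10, 15, 25], [0, 11, 15, 18], [0, 11, 16, 29],
     [0, 11, 17, 23], [0, 11, 19, 27], [0, 15, 21, 29], [0, 17, 19, 25], [0, 17, 21, 27],
     [1, 7, 17, 21], [1, 9, 13, 21]]

/-- The automorphism of order 24 used in `candelabraFour`. -/
def rotation30 (x : ℕ) : ℕ :=
  if x < 18 then x + 6
  else if x < 24 then (x + 1) % 6
  else if x < 27 then 24 + (x + 1) % 3 else 27 + (x + 1) % 3

/-- A candelabra system with four groups of size six and a stem of size six whose last point is
removed together with its blocks. -/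
def candelabraFour : List (List ℕ) :=
  List.filter (29 ∉ ·) <|
  orbits rotation30 24
    [[0, 1, 6, 10], [0, 1, 7, 8], [0, 1, 9, 21], [0, 1, 11, 19], [0, 1, 12, 15], [0, 1, 13, 14],
     [0, 1, 18, 20], [0, 2, 7, 13], [0, 2, 8, 10], [0, 2, 9, 22], [0, 2, 12, 18], [0, 2, 14, 16],
     [0, 3, 6, 20], [0, 3, 8, 21], [0, 6, 12, 27], [0, 6, 14, 28], [0, 6, 16, 25], [0, 6, 19, 24],
     [0, 6, 21, 26], [0, 7, 12, 29], [0, 7, 14, 24], [0, 7, 15, 28], [0, 7, 17, 21], [0, 7, 18, 26],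
     [0, 7, 19, 27], [0, 8, 12, 25], [0, 8, 13, 28], [0, 8, 18, 24], [0, 9, 12, 24], [0, 9, 13, 29],
     [0, 9, 14, 27], [0, 9, 18, 25], [0, 9, 19, 28]] ++
  orbits rotation30 12
    [[0, 3, 7, 10]] ++
  orbits rotation30 6
    [[0, 3, 13, 16]]

/-- An automorphism of order twelve of `packingWithHole`. -/
def rotation29 (x : ℕ) : ℕ :=
  if x < 12 then (x + 1) % 12 else if x < 24 then 12 + (x + 1) % 12 else x

/-- An optimal packing on 29 points with a hole of size five. -/
def packingWithHole : List (List ℕ) :=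
  orbits rotation29 12
    [[0, 1, 2, 6], [0, 1, 3, 24], [0, 1, 4, 27], [0, 1, 7, 20], [0, 1, 8, 28], [0, 1, 9, 13],
     [0, 1, 10, 15], [0, 1, 14, 23], [0, 1, 16, 22], [0, 1, 17, 25], [0, 1, 18, 21], [0, 1, 19, 26],
     [0, 2, 4, 13], [0, 2, 7, 12], [0, 2, 8, 22], [0, 2, 9, 26], [0, 2, 14, 25], [0, 2, 15, 19],
     [0, 2, 16, 21], [0, 2, 18, 28], [0, 2, 20, 27], [0, 3, 6, 12], [0, 3, 7, 23], [0, 3, 8, 25],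
     [0, 3, 13, 28], [0, 3, 14, 18], [0, 3, 15, 22], [0, 3, 19, 20], [0, 4, 12, 24], [0, 4, 15, 26],
     [0, 4, 17, 22], [0, 4, 18, 19], [0, 4, 21, 23], [0, 5, 12, 15], [0, 5, 14, 27], [0, 5, 18, 24],
     [0, 5, 19, 21], [0, 5, 20, 23], [0, 6, 15, 16], [0, 12, 13, 23], [0, 12, 16, 27],
     [0, 12, 17, 28], [0, 12, 18, 22], [0, 12, 20, 26], [0, 13, 14, 26], [0, 13, 15, 25],
     [0, 13, 16, 19], [0, 13, 20, 21], [0, 14, 17, 21], [0, 14, 20, 22], [0, 14, 24, 28],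
     [0, 15, 17, 24], [0, 15, 27, 28], [0, 16, 18, 20], [0, 16, 23, 24], [0, 17, 26, 27],
     [0, 18, 23, 25], [0, 19, 23, 28], [0, 19, 24, 27], [0, 20, 25, 28], [0, 21, 24, 25],
     [0, 21, 26, 28], [0, 22, 23, 27], [0, 22, 25, 26], [12, 13, 15, 20], [12, 13, 16, 25],
     [12, 13, 21, 24], [12, 13, 22, 28], [12, 14, 17, 26], [12, 14, 21, 27]] ++
  orbits rotation29 6
    [[0, 6, 17, 23], [0, 6, 24, 26], [0, 6, 25, 27], [12, 13, 18, 19], [12, 18, 24, 26],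
     [12, 18, 25, 27]]

/-- An automorphism of order eight of `packing23`. -/
def rotation23 (x : ℕ) : ℕ :=
  if x < 8 then (x + 1) % 8
  else if x < 16 then 8 + (x + 1) % 8
  else if x < 20 then 16 + (x + 1) % 4
  else if x < 22 then 41 - x else x

/-- An optimal packing on 23 points. -/
def packing23 : List (List ℕ) :=
  orbits rotation23 8
    [[0, 1, 2, 10], [0, 1, 6, 21], [0, 1, 8, 13], [0, 1, 11, 20], [0, 1, 12, 14], [0, 1, 15, 19],
     [0, 1, 16, 22], [0, 1, 17, 18], [0, 2, 4, 15], [0, 2, 5, 17], [0, 2, 8, 20], [0, 2, 9, 16],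
     [0, 2, 11, 22], [0, 2, 12, 18], [0, 2, 14, 19], [0, 3, 8, 22], [0, 3, 9, 10], [0, 3, 11, 12],
     [0, 3, 13, 15], [0, 3, 14, 17], [0, 3, 18, 20], [0, 4, 9, 14], [0, 8, 10, 19], [0, 8, 11, 17],
     [0, 8, 14, 16], [0, 8, 15, 21], [0, 9, 11, 15], [0, 9, 12, 13], [0, 9, 17, 21], [0, 9, 18, 19],
     [0, 10, 11, 14], [0, 10, 17, 20], [0, 10, 18, 22], [0, 11, 16, 19], [0, 12, 16, 21],
     [0, 12, 20, 22], [0, 13, 16, 18], [0, 13, 17, 19], [0, 13, 20, 21], [0, 14, 21, 22],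
     [0, 15, 16, 20], [0, 15, 17, 22], [8, 9, 10, 17], [8, 9, 11, 22], [8, 9, 14, 18],
     [8, 9, 19, 21], [8, 10, 13, 21], [8, 11, 18, 19]] ++
  orbits rotation23 4
    [[0, 1, 4, 5], [0, 4, 8, 12], [0, 4, 18, 21], [0, 4, 19, 20], [8, 12, 17, 20], [8, 12, 18, 21],
     [8, 12, 19, 22], [16, 17, 20, 22]] ++
  orbits rotation23 2
    [[16, 18, 20, 21]] ++
  orbits rotation23 1
    [[16, 17, 18, 19]]

lemma isIngredient_candelabraThree : IsIngredient 4 [3] 3 candelabraThree :=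
  ⟨isPackingList_of_masksDisjoint (by decide +kernel), by decide +kernel⟩

lemma isIngredient_candelabraFour : IsIngredient 5 [4] 3 candelabraFour :=
  ⟨isPackingList_of_masksDisjoint (by decide +kernel), by decide +kernel⟩

lemma isIngredient_hDesignFour : IsIngredient 4 [] 3 hDesignFour :=
  ⟨isPackingList_of_masksDisjoint (by decide +kernel), by decide +kernel⟩

lemma isIngredient_hDesignFive : IsIngredient 5 [] 3 hDesignFive :=
  ⟨isPackingList_of_masksDisjoint (by decide +kernel), by decide +kernel⟩

lemma isIngredient_packingWithHole : IsIngredient 5 [4] 2 packingWithHole :=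
  ⟨isPackingList_of_masksDisjoint (by decide +kernel), by decide +kernel⟩

lemma isIngredient_packing23 : IsIngredient 4 [3] 0 packing23 :=
  ⟨isPackingList_of_masksDisjoint (by decide +kernel), by decide +kernel⟩

/-! ### The configuration of cells

The groups of the cells are the circles of the inversive plane of order four with one of its
seventeen points removed. The circles through the removed point and the stem, and the others in one
parallel class with respect to the stem, carry the packings that cover the remaining triples. -/

/-- The circles of size four through the stem. -/
def stemCirclesFour : List (List ℕ) :=
  [[0, 6, 10, 15], [1, 5, 8, 15], [2, 7, 9, 15], [3, 4, 11, 15]]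

/-- The circles of size five through the stem, outside the parallel class. -/
def stemCirclesFive : List (List ℕ) :=
  [[0, 4, 9, 12, 15], [0, 5, 11, 13, 15], [0, 7, 8, 14, 15], [1, 4, 10, 14, 15], [1, 6, 9, 13, 15],
   [1, 7, 11, 12, 15], [2, 4, 8, 13, 15], [2, 5, 10, 12, 15], [2, 6, 11, 14, 15], [3, 5, 9, 14, 15],
   [3, 6, 8, 12, 15], [3, 7, 10, 13, 15]]

/-- The circles of size four that avoid the stem. -/
def circlesFour : List (List ℕ) :=
  [[0, 1, 4, 7], [0, 2, 5, 14], [0, 3, 9, 13], [0, 8, 11, 12], [1, 2, 11, 13], [1, 3, 6, 14],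
   [1, 9, 10, 12], [2, 3, 8, 10], [2, 4, 6, 12], [3, 5, 7, 12], [4, 5, 10, 13], [4, 8, 9, 14],
   [5, 6, 9, 11], [6, 7, 8, 13], [7, 10, 11, 14]]

/-- The circles of size five that avoid the stem. -/
def circlesFive : List (List ℕ) :=
  [[0, 1, 5, 6, 12], [0, 1, 8, 10, 13], [0, 1, 9, 11, 14], [0, 2, 4, 10, 11], [0, 2, 6, 8, 9],
   [0, 2, 7, 12, 13], [0, 3, 4, 5, 8], [0, 3, 6, 7, 11], [0, 3, 10, 12, 14], [0, 4, 6, 13, 14],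
   [0, 5, 7, 9, 10], [1, 2, 4, 5, 9], [1, 2, 6, 7, 10], [1, 2, 8, 12, 14], [1, 3, 4, 12, 13],
   [1, 3, 5, 10, 11], [1, 3, 7, 8, 9], [1, 4, 6, 8, 11], [1, 5, 7, 13, 14], [2, 3, 4, 7, 14],
   [2, 3, 5, 6, 13], [2, 3, 9, 11, 12], [2, 5, 7, 8, 11], [2, 9, 10, 13, 14], [3, 4, 6, 9, 10],
   [3, 8, 11, 13, 14], [4, 5, 11, 12, 14], [4, 7, 8, 10, 12], [4, 7, 9, 11, 13], [5, 6, 8, 10, 14],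
   [5, 8, 9, 12, 13], [6, 7, 9, 12, 14], [6, 10, 11, 12, 13]]

/-- The circles of size five in the parallel class. -/
def parallelCircles : List (List ℕ) :=
  [[0, 1, 2, 3, 15], [4, 5, 6, 7, 15], [8, 9, 10, 11, 15]]

/-- The cells of the configuration, with their packings. -/
def cells : List Cell :=
  stemCirclesFour.map (⟨·, [3], 3, candelabraThree⟩) ++
    stemCirclesFive.map (⟨·, [4], 3, candelabraFour⟩) ++
    circlesFour.map (⟨·, [], 3, hDesignFour⟩) ++ circlesFive.map (⟨·, [], 3, hDesignFive⟩) ++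
    parallelCircles.map (⟨·, [4], 2, packingWithHole⟩) ++ [⟨[12, 13, 14, 15], [3], 0, packing23⟩]

lemma hasGoodGroups_of_mem_cells : ∀ c ∈ cells, c.HasGoodGroups := by decide +kernel

lemma pairwise_isSeparated_cells : cells.Pairwise Cell.IsSeparated := by decide +kernel

lemma length_stemCirclesFour : ∀ g ∈ stemCirclesFour, g.length = 4 := by decide +kernel

lemma length_stemCirclesFive : ∀ g ∈ stemCirclesFive, g.length = 5 := by decide +kernel

lemma length_circlesFour : ∀ g ∈ circlesFour, g.length = 4 := by decide +kernel

lemma length_circlesFive : ∀ g ∈ circlesFive, g.length = 5 := by decide +kernel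

lemma length_parallelCircles : ∀ g ∈ parallelCircles, g.length = 5 := by decide +kernel

lemma isValid_of_mem_cells : ∀ c ∈ cells, c.IsValid := by
  intro c hc
  refine ⟨hasGoodGroups_of_mem_cells c hc, ?_⟩
  simp only [cells, List.mem_append, List.mem_map, List.mem_singleton] at hc
  obtain ((((⟨g, hg, rfl⟩ | ⟨g, hg, rfl⟩) | ⟨g, hg, rfl⟩) | ⟨g, hg, rfl⟩) | ⟨g, hg, rfl⟩) | rfl := hc
  · simpa only [length_stemCirclesFour g hg] using isIngredient_candelabraThree
  · simpa only [length_stemCirclesFive g hg] using isIngredient_candelabraFour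
  · simpa only [length_circlesFour g hg] using isIngredient_hDesignFour
  · simpa only [length_circlesFive g hg] using isIngredient_hDesignFive
  · simpa only [length_parallelCircles g hg] using isIngredient_packingWithHole
  · exact isIngredient_packing23

lemma sum_length_blocks_cells : (cells.map fun c => c.blocks.length).sum = 34223 := by
  decide +kernel

/-- A(95,4,4) = J(95,4,4). -/
theorem packingNumber_95 : packingNumber 95 = johnsonBound 95 := by
  have hJ : johnsonBound 95 = 34223 := by norm_num [johnsonBound]
  obtain ⟨B, hB, hcard⟩ := Cell.exists_isPQS cells isValid_of_mem_cells pairwise_isSeparated_cells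
  rw [sum_length_blocks_cells] at hcard
  rw [hJ]
  refine IsGreatest.csSup_eq ⟨⟨B, hB, hcard⟩, ?_⟩
  rintro _ ⟨B', hB', rfl⟩
  exact hB'.card_le
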